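/- Let G be a cyclically 5-edge-connected cubic graph and let E(U,U′) be a 5-edge-cut of G. If the graph G/U is matching covered, then G/U is cyclically 5-edge-connected and 3-vertex-connected. -/

import Mathlib

open scoped Classical

noncomputable section

/-- A finite multigraph: finitely many vertices and edges, each edge has an
unordered pair of endpoints (parallel edges and loops are allowed). -/
structure Multigraph where
  V : Type
  E : Type
  fintypeV : Fintype V := by infer_instance
  fintypeE : Fintype E := by infer_instance
  ends : E → Sym2 V

namespace Multigraph

instance (G : Multigraph) : Fintype G.V := G.fintypeV
instance (G : Multigraph) : Fintype G.E := G.fintypeE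

/-- The number of endpoints of the edge `e` that are equal to `v`
(a loop at `v` counts twice). -/
def inc (G : Multigraph) (v : G.V) (e : G.E) : ℕ :=
  if G.ends e = Sym2.diag v then 2 else if v ∈ G.ends e then 1 else 0

/-- The degree of a vertex: the number of edge-ends at it (loops count twice). -/
def degree (G : Multigraph) (v : G.V) : ℕ := ∑ e : G.E, G.inc v e

/-- A graph is cubic if every vertex has degree three. -/
def IsCubic (G : Multigraph) : Prop := ∀ v : G.V, G.degree v = 3

/-- A perfect matching: a set of (non-loop) edges such that every vertex is
incident with exactly one edge of the set. -/
def IsPerfectMatching (G : Multigraph) (M : Finset G.E) : Prop :=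
  (∀ e ∈ M, ¬ (G.ends e).IsDiag) ∧
  ∀ v : G.V, ∃! e, e ∈ M ∧ v ∈ G.ends e

/-- The number of perfect matchings of `G`. -/
def pmCount (G : Multigraph) : ℕ :=
  Nat.card {M : Finset G.E // G.IsPerfectMatching M}

/-- Every edge lies in some perfect matching. -/
def MatchingCovered (G : Multigraph) : Prop :=
  ∀ e : G.E, ∃ M, G.IsPerfectMatching M ∧ e ∈ M

/-- Every edge lies in at least two perfect matchings. -/
def MatchingDoubleCovered (G : Multigraph) : Prop :=
  ∀ e : G.E, 2 ≤ Nat.card {M : Finset G.E // G.IsPerfectMatching M ∧ e ∈ M}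

/-- Adjacency via some edge. -/
def Adj (G : Multigraph) (u v : G.V) : Prop := ∃ e : G.E, G.ends e = s(u, v)

/-- The graph is connected. -/
def Connected (G : Multigraph) : Prop :=
  Nonempty G.V ∧ ∀ u v : G.V, Relation.ReflTransGen G.Adj u v

/-- The edge-cut `E(A, Aᶜ)`: edges with one end in `A` and the other outside. -/
def cutEdges (G : Multigraph) (A : Set G.V) : Set G.E :=
  {e | ∃ u v, G.ends e = s(u, v) ∧ u ∈ A ∧ v ∉ A}

/-- `G` is `k`-edge-connected: no edge-cut has fewer than `k` edges. -/
def EdgeConnected (G : Multigraph) (k : ℕ) : Prop :=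
  ∀ A : Set G.V, A.Nonempty → A ≠ Set.univ → k ≤ (G.cutEdges A).ncard

/-- Bridgeless = 2-edge-connected: connected with no edge-cut of size `< 2`. -/
def Bridgeless (G : Multigraph) : Prop := G.Connected ∧ G.EdgeConnected 2

/-- The subgraph induced on `A` contains a cycle (two parallel edges count as a
cycle of length two): there is a nonempty set of edges inside `A` in which every
vertex is incident with zero or at least two edge-ends. -/
def HasCycleWithin (G : Multigraph) (A : Set G.V) : Prop :=
  ∃ F : Finset G.E, F.Nonempty ∧ (∀ e ∈ F, ∀ v ∈ G.ends e, v ∈ A) ∧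
    ∀ v : G.V, (∑ e ∈ F, G.inc v e) ≠ 1

/-- The edge-cut `E(A, Aᶜ)` is cyclic: both sides contain a cycle. -/
def IsCyclicCut (G : Multigraph) (A : Set G.V) : Prop :=
  G.HasCycleWithin A ∧ G.HasCycleWithin Aᶜ

/-- `G` is cyclically `k`-edge-connected: no cyclic edge-cut has fewer than `k` edges. -/
def CyclicallyEdgeConnected (G : Multigraph) (k : ℕ) : Prop :=
  ∀ A : Set G.V, G.IsCyclicCut A → k ≤ (G.cutEdges A).ncard

/-- A cut is tight: every perfect matching contains exactly one of its edges. -/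
def IsTightCut (G : Multigraph) (A : Set G.V) : Prop :=
  ∀ M : Finset G.E, G.IsPerfectMatching M →
    (M.filter (fun e => e ∈ G.cutEdges A)).card = 1

/-- Adjacency within a set `A` of vertices. -/
def AdjOn (G : Multigraph) (A : Set G.V) (u v : G.V) : Prop :=
  u ∈ A ∧ v ∈ A ∧ G.Adj u v

/-- The subgraph induced on `A` is connected (any two of its vertices are joined
by a walk inside `A`). -/
def ConnectedOn (G : Multigraph) (A : Set G.V) : Prop :=
  ∀ u ∈ A, ∀ v ∈ A, Relation.ReflTransGen (G.AdjOn A) u v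

/-- `G` is `k`-vertex-connected: it has at least `k+1` vertices and removing any
set of at most `k-1` vertices leaves it connected. -/
def VertexConnected (G : Multigraph) (k : ℕ) : Prop :=
  k + 1 ≤ Fintype.card G.V ∧
  ∀ T : Set G.V, T.ncard ≤ k - 1 → G.ConnectedOn Tᶜ

/-- `{x, y}` is a 2-vertex-cut: removing both vertices disconnects the graph. -/
def IsVertexCutPair (G : Multigraph) (x y : G.V) : Prop :=
  x ≠ y ∧ ¬ G.ConnectedOn ({x, y}ᶜ)

/-- `G` is bipartite: the vertices split into two classes so that each edge
joins the two classes. -/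
def Bipartite (G : Multigraph) : Prop :=
  ∃ X : Set G.V, ∀ e : G.E, ∃ u v, G.ends e = s(u, v) ∧ u ∈ X ∧ v ∉ X

/-- Delete a set of edges (keeping all vertices). -/
def deleteEdges (G : Multigraph) (F : Set G.E) : Multigraph where
  V := G.V
  E := {e : G.E // e ∉ F}
  ends e := G.ends e.1

/-- Contract the vertex set `A` to a single vertex (`none`), deleting the arising
loops and keeping parallel edges. -/
def contract (G : Multigraph) (A : Set G.V) : Multigraph where
  V := Option {x : G.V // x ∉ A}
  E := {e : G.E // ¬ ∀ v ∈ G.ends e, v ∈ A}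
  ends e := (G.ends e.1).map fun x => if h : x ∈ A then none else some ⟨x, h⟩

/-- Isomorphism of multigraphs. -/
def Iso (G₁ G₂ : Multigraph) : Prop :=
  ∃ (f : G₁.V ≃ G₂.V) (g : G₁.E ≃ G₂.E), ∀ e, G₂.ends (g e) = (G₁.ends e).map f

/-- The complete graph on four vertices. -/
def K4 : Multigraph where
  V := Fin 4
  E := {p : Fin 4 × Fin 4 // p.1 < p.2}
  ends p := s(p.1.1, p.1.2)

/-- The result of simultaneously replacing every vertex of `S` by a triangle;
`σ e v` records to which of the three triangle vertices at `v` the edge `e`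
(formerly ending at `v`) is attached. -/
def expandTriangles (H : Multigraph) (S : Set H.V) (σ : H.E → H.V → Fin 3) :
    Multigraph where
  V := {x : H.V // x ∉ S} ⊕ (S × Fin 3)
  E := H.E ⊕ (S × Fin 3)
  ends e :=
    match e with
    | Sum.inl e => (H.ends e).map fun x =>
        if h : x ∈ S then Sum.inr (⟨x, h⟩, σ e x) else Sum.inl ⟨x, h⟩
    | Sum.inr (w, i) => s(Sum.inr (w, i + 1), Sum.inr (w, i + 2))

/-- `G` is obtained from `H` by replacing each vertex of `S` with a triangle:
the three edges formerly incident with a vertex of `S` get attached to the three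
distinct new triangle vertices. -/
def IsTriangleExpansion (H : Multigraph) (S : Set H.V) (G : Multigraph) : Prop :=
  ∃ σ : H.E → H.V → Fin 3,
    (∀ v ∈ S, ∀ e : H.E, H.ends e ≠ Sym2.diag v) ∧
    (∀ v ∈ S, Set.InjOn (fun e => σ e v) {e : H.E | v ∈ H.ends e}) ∧
    Iso (expandTriangles H S σ) G

/-- Klee-graphs: `K₄` together with everything obtainable by repeatedly replacing
a vertex with a triangle. -/
inductive IsKlee : Multigraph → Prop
  | k4 (G : Multigraph) : Iso K4 G → IsKlee G
  | expand (G : Multigraph) (v : G.V) (H : Multigraph) :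
      IsKlee G → IsTriangleExpansion G {v} H → IsKlee H

/-- A nice 3-edge-cut (of a cubic graph). -/
def IsNiceCut (G : Multigraph) (A : Set G.V) : Prop :=
  A.Nonempty ∧ A ≠ Set.univ ∧ (G.cutEdges A).ncard = 3 ∧
  ¬ IsKlee (G.contract A) ∧
  (¬ IsKlee (G.contract Aᶜ) ∨
   9 ≤ A.ncard ∨
   (5 ≤ A.ncard ∧ ¬ G.IsTightCut A) ∨
   (A.ncard = 3 ∧
     2 ≤ Nat.card {M : Finset G.E // G.IsPerfectMatching M ∧
       ∀ e ∈ G.cutEdges A, e ∈ M}))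

/-- A brace: a bipartite matching covered graph without nontrivial tight edge-cuts. -/
def IsBrace (H : Multigraph) : Prop :=
  H.Bipartite ∧ H.MatchingCovered ∧
  ∀ A : Set H.V, 2 ≤ A.ncard → 2 ≤ Aᶜ.ncard → ¬ H.IsTightCut A

/-- Data describing a simultaneous gluing of graphs `K w` (through their vertices
`z w`) onto the vertices `w ∈ W` of `H`: the edge `e` of `H` incident with `w`
is identified with the edge `ε w e` of `K w` incident with `z w`, whose other
end is `y w e`. -/
structure GlueData (H : Multigraph) (W : Set H.V) where
  K : W → Multigraph
  z : (w : W) → (K w).V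
  d : (w : W) → {x : (K w).V // x ≠ z w}
  ε : (w : W) → H.E → (K w).E
  y : (w : W) → H.E → {x : (K w).V // x ≠ z w}
  noloop : ∀ (w : W) (e : H.E), H.ends e ≠ Sym2.diag (w : H.V)
  noloopK : ∀ (w : W) (k : (K w).E), (K w).ends k ≠ Sym2.diag (z w)
  ends_eq : ∀ (w : W) (e : H.E), (w : H.V) ∈ H.ends e →
      (K w).ends (ε w e) = s(z w, (y w e : (K w).V))
  inj : ∀ w : W, Set.InjOn (ε w) {e : H.E | (w : H.V) ∈ H.ends e}
  surj : ∀ (w : W) (k : (K w).E), z w ∈ (K w).ends k →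
      ∃ e : H.E, (w : H.V) ∈ H.ends e ∧ ε w e = k

/-- The graph obtained by gluing each `D.K w` through `D.z w` onto the vertex
`w ∈ W` of `H`. -/
def glue (H : Multigraph) (W : Set H.V) (D : GlueData H W) : Multigraph where
  V := {x : H.V // x ∉ W} ⊕ (Σ w : W, {x : (D.K w).V // x ≠ D.z w})
  E := H.E ⊕ (Σ w : W, {k : (D.K w).E // D.z w ∉ (D.K w).ends k})
  ends e :=
    match e with
    | Sum.inl e => (H.ends e).map fun x =>
        if h : x ∈ W then Sum.inr ⟨⟨x, h⟩, D.y ⟨x, h⟩ e⟩ else Sum.inl ⟨x, h⟩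
    | Sum.inr ⟨w, k⟩ => ((D.K w).ends k.1).map fun x =>
        if h : x = D.z w then Sum.inr ⟨w, D.d w⟩ else Sum.inr ⟨w, ⟨x, h⟩⟩

/-- The multiset of vertex degrees different from three. -/
def nonCubicDegrees (G : Multigraph) : Multiset ℕ :=
  ((Finset.univ : Finset G.V).val.map G.degree).filter (· ≠ 3)

/-- `H` is an odd minor of `G`: it is obtained by contracting pairwise disjoint
connected subgraphs, each with an odd number of vertices (deleting arising loops
and keeping parallel edges). -/
def IsOddMinor (G H : Multigraph) : Prop :=
  ∃ π : G.V → H.V, Function.Surjective π ∧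
    (∀ w : H.V, G.ConnectedOn (π ⁻¹' {w}) ∧ Odd (π ⁻¹' {w}).ncard) ∧
    ∃ g : {e : G.E // ∃ u v, G.ends e = s(u, v) ∧ π u ≠ π v} ≃ H.E,
      ∀ e, H.ends (g e) = (G.ends e.1).map π

/-- The 6-vertex graph consisting of two nonadjacent vertices `x = 0`, `y = 1`
and four vertices `a = 2`, `b = 3`, `c = 4`, `d = 5`, with edges `ab`, `cd` and
an edge from each of `a`, `b`, `c`, `d` to each of `x` and `y`. -/
def specialGraph : Multigraph where
  V := Fin 6
  E := Fin 10
  ends := ![s(2, 3), s(4, 5), s(2, 0), s(2, 1), s(3, 0), s(3, 1),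
            s(4, 0), s(4, 1), s(5, 0), s(5, 1)]

/-- The perfect matching polytope: the convex hull of the characteristic vectors
of the perfect matchings. -/
def pmPolytope (G : Multigraph) : Set (G.E → ℝ) :=
  convexHull ℝ {w | ∃ M : Finset G.E, G.IsPerfectMatching M ∧
    w = fun e => if e ∈ M then (1 : ℝ) else 0}

end Multigraph

open Multigraph

namespace Multigraph

variable {G : Multigraph}

theorem inc_of_ends {e : G.E} {a b : G.V} (h : G.ends e = s(a, b)) (v : G.V) :
    G.inc v e = (if v = a then 1 else 0) + (if v = b then 1 else 0) := by
  unfold inc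
  rw [h]
  have hd : s(a, b) = Sym2.diag v ↔ v = a ∧ v = b := by
    simp only [Sym2.diag, Sym2.eq_iff, or_self, eq_comm]
  simp only [hd, Sym2.mem_iff]
  split_ifs <;> simp_all

theorem mem_cutEdges_of_ends {e : G.E} {a b : G.V} (h : G.ends e = s(a, b)) (A : Set G.V) :
    e ∈ G.cutEdges A ↔ (a ∈ A ∧ b ∉ A) ∨ (b ∈ A ∧ a ∉ A) := by
  constructor
  · rintro ⟨u, v, huv, hu, hv⟩
    rw [h, Sym2.eq_iff] at huv
    rcases huv with ⟨rfl, rfl⟩ | ⟨rfl, rfl⟩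
    · exact Or.inl ⟨hu, hv⟩
    · exact Or.inr ⟨hu, hv⟩
  · rintro (⟨h1, h2⟩ | ⟨h1, h2⟩)
    · exact ⟨a, b, h, h1, h2⟩
    · exact ⟨b, a, h.trans Sym2.eq_swap, h1, h2⟩

theorem exists_ends (e : G.E) : ∃ a b, G.ends e = s(a, b) := by
  induction h : G.ends e with
  | h a b => exact ⟨a, b, rfl⟩

theorem cutEdges_compl (A : Set G.V) : G.cutEdges Aᶜ = G.cutEdges A := by
  ext e
  obtain ⟨a, b, h⟩ := exists_ends e
  rw [mem_cutEdges_of_ends h, mem_cutEdges_of_ends h]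
  simp only [Set.mem_compl_iff, not_not]
  tauto

theorem ncard_cutEdges_eq_sum (A : Set G.V) :
    (G.cutEdges A).ncard = ∑ e : G.E, if e ∈ G.cutEdges A then 1 else 0 := by
  rw [Set.ncard_eq_toFinset_card', Finset.sum_boole, Nat.cast_id]
  congr 1
  ext
  simp

/-- The edges with all their ends in `A`. -/
def innerEdges (G : Multigraph) (A : Set G.V) : Finset G.E :=
  Finset.univ.filter fun e => ∀ v ∈ G.ends e, v ∈ A

theorem sum_inc (A : Set G.V) (e : G.E) :
    ∑ v ∈ A.toFinset, G.inc v e =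
      2 * (if e ∈ G.innerEdges A then 1 else 0) + if e ∈ G.cutEdges A then 1 else 0 := by
  obtain ⟨a, b, h⟩ := exists_ends e
  simp only [inc_of_ends h, mem_cutEdges_of_ends h, innerEdges, h, Finset.sum_add_distrib,
    Finset.sum_ite_eq', Set.mem_toFinset, Finset.mem_filter, Finset.mem_univ, true_and,
    Sym2.mem_iff, forall_eq_or_imp, forall_eq]
  by_cases ha : a ∈ A <;> by_cases hb : b ∈ A <;> simp [ha, hb]

theorem IsCubic.three_mul_ncard (hG : G.IsCubic) (A : Set G.V) :
    3 * A.ncard = 2 * (G.innerEdges A).card + (G.cutEdges A).ncard := by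
  have h1 : ∑ v ∈ A.toFinset, G.degree v = 3 * A.ncard := by
    rw [Finset.sum_congr rfl fun v _ => hG v, Finset.sum_const, smul_eq_mul,
      Set.ncard_eq_toFinset_card', mul_comm]
  rw [← h1]
  unfold degree
  rw [Finset.sum_comm, Finset.sum_congr rfl fun e _ => sum_inc A e, Finset.sum_add_distrib,
    ← Finset.mul_sum, ncard_cutEdges_eq_sum]
  simp

/-- A nonempty set of edges spanning at most as many vertices as edges contains a cycle. -/
theorem hasCycleWithin_of_card_le (A : Set G.V) (F : Finset G.E) (hF : F.Nonempty)
    (hFA : ∀ e ∈ F, ∀ v ∈ G.ends e, v ∈ A) (hcard : A.ncard ≤ F.card) :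
    G.HasCycleWithin A := by
  induction hn : F.card generalizing A F with
  | zero => simp_all
  | succ n ih =>
    by_cases hdeg : ∀ v : G.V, (∑ e ∈ F, G.inc v e) ≠ 1
    · exact ⟨F, hF, hFA, hdeg⟩
    push Not at hdeg
    obtain ⟨v, hv⟩ := hdeg
    obtain ⟨e, he, hve, hrest⟩ :
        ∃ e ∈ F, G.inc v e = 1 ∧ ∀ f ∈ F, f ≠ e → G.inc v f = 0 := by
      obtain ⟨e, he, hne⟩ := Finset.exists_ne_zero_of_sum_ne_zero (hv.trans_ne one_ne_zero)
      rw [← Finset.add_sum_erase F _ he] at hv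
      refine ⟨e, he, by omega, fun f hf hfe => ?_⟩
      have h0 : ∑ x ∈ F.erase e, G.inc v x = 0 := by omega
      exact Finset.sum_eq_zero_iff.1 h0 f (Finset.mem_erase.2 ⟨hfe, hf⟩)
    obtain ⟨a, b, hab⟩ := exists_ends e
    have haA : a ∈ A := hFA e he a (by simp [hab])
    have hbA : b ∈ A := hFA e he b (by simp [hab])
    rw [inc_of_ends hab] at hve
    have hvA : v ∈ A := by
      by_cases h1 : v = a
      · exact h1 ▸ haA
      by_cases h2 : v = b
      · exact h2 ▸ hbA
      simp [h1, h2] at hve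
    have hdiff : (A \ {v}).ncard + 1 = A.ncard := Set.ncard_sdiff_singleton_add_one hvA
    have herase : (F.erase e).card + 1 = F.card := Finset.card_erase_add_one he
    have hpos : 0 < (A \ {v}).ncard := by
      rw [Set.ncard_pos]
      by_cases h1 : v = a
      · refine ⟨b, hbA, fun h2 => ?_⟩
        simp only [Set.mem_singleton_iff] at h2
        simp [h1, h2.symm ▸ h1] at hve
      · exact ⟨a, haA, fun h2 => h1 h2.symm⟩
    obtain ⟨F', hF', hFA', hd⟩ := ih (A \ {v}) (F.erase e)
      (Finset.card_pos.1 (by omega))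
      (fun f hf w hw => by
        rw [Finset.mem_erase] at hf
        refine ⟨hFA f hf.2 w hw, ?_⟩
        rintro rfl
        have h0 := hrest f hf.2 hf.1
        obtain ⟨c, d, hcd⟩ := exists_ends f
        rw [inc_of_ends hcd] at h0
        rw [hcd, Sym2.mem_iff] at hw
        rcases hw with rfl | rfl <;> simp at h0) (by omega) (by omega)
    exact ⟨F', hF', fun f hf w hw => (hFA' f hf w hw).1, hd⟩

theorem IsCubic.ncard_add_two_le (hG : G.IsCubic) {A : Set G.V} (hA : A.Nonempty)
    (hcyc : ¬ G.HasCycleWithin A) : A.ncard + 2 ≤ (G.cutEdges A).ncard := by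
  have h := hG.three_mul_ncard A
  have hpos : 0 < A.ncard := (Set.ncard_pos).2 hA
  by_contra hlt
  refine hcyc (hasCycleWithin_of_card_le A (G.innerEdges A) (Finset.card_pos.1 (by omega))
    (fun e he => (Finset.mem_filter.1 he).2) (by omega))

section FiveCut

variable {U : Set G.V}

theorem IsCubic.five_le_ncard_cutEdges (hG : G.IsCubic) (h5 : G.CyclicallyEdgeConnected 5)
    (hcut : (G.cutEdges U).ncard = 5) {B : Set G.V} (hB : B ⊆ Uᶜ)
    (hcyc : G.HasCycleWithin B) : 5 ≤ (G.cutEdges B).ncard := by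
  by_cases hc : G.HasCycleWithin Bᶜ
  · exact h5 B ⟨hcyc, hc⟩
  have hUB : U ⊆ Bᶜ := fun x hx hxB => hB hxB hx
  have h3 := hG.three_mul_ncard U
  have hle : U.ncard ≤ Bᶜ.ncard := Set.ncard_le_ncard hUB
  have hne : (Bᶜ).Nonempty := (Set.ncard_pos).1 (by omega)
  have := hG.ncard_add_two_le hne hc
  rw [cutEdges_compl] at this
  omega

theorem IsCubic.min_le_ncard_cutEdges (hG : G.IsCubic) (h5 : G.CyclicallyEdgeConnected 5)
    (hcut : (G.cutEdges U).ncard = 5) {B : Set G.V} (hB : B ⊆ Uᶜ) (hne : B.Nonempty) :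
    min 5 (B.ncard + 2) ≤ (G.cutEdges B).ncard := by
  by_cases hc : G.HasCycleWithin B
  · exact (min_le_left _ _).trans (hG.five_le_ncard_cutEdges h5 hcut hB hc)
  · exact (min_le_right _ _).trans (hG.ncard_add_two_le hne hc)

/-- If `S` separates `P` from the remaining vertices, then the cuts around `P` and `P ∪ S`
together have at most three times as many edges as `S` has vertices. -/
theorem IsCubic.ncard_cutEdges_add_le (hG : G.IsCubic) {P S : Set G.V} (hPS : Disjoint P S)
    (hsep : ∀ a ∈ P, ∀ b ∉ P ∪ S, ¬ G.Adj a b) :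
    (G.cutEdges P).ncard + (G.cutEdges (P ∪ S)).ncard ≤ 3 * S.ncard := by
  rw [hG.three_mul_ncard S, ncard_cutEdges_eq_sum, ncard_cutEdges_eq_sum,
    ncard_cutEdges_eq_sum S, ← Finset.sum_add_distrib]
  have hin : (G.innerEdges S).card = ∑ e : G.E, if e ∈ G.innerEdges S then 1 else 0 := by simp
  rw [hin, Finset.mul_sum, ← Finset.sum_add_distrib]
  refine Finset.sum_le_sum fun e _ => ?_
  obtain ⟨a, b, h⟩ := exists_ends e
  have h1 : a ∈ P → b ∉ P ∪ S → False := fun ha hb => hsep a ha b hb ⟨e, h⟩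
  have h2 : b ∈ P → a ∉ P ∪ S → False :=
    fun hb ha => hsep b hb a ha ⟨e, h.trans Sym2.eq_swap⟩
  have h3 : a ∈ P → a ∉ S := fun h => Set.disjoint_left.1 hPS h
  have h4 : b ∈ P → b ∉ S := fun h => Set.disjoint_left.1 hPS h
  simp only [mem_cutEdges_of_ends h, Set.mem_union, innerEdges, h, Finset.mem_filter,
    Finset.mem_univ, true_and, Sym2.mem_iff, forall_eq_or_imp, forall_eq] at h1 h2 ⊢
  by_cases ha : a ∈ P <;> by_cases hb : b ∈ P <;> by_cases ha' : a ∈ S <;>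
    by_cases hb' : b ∈ S <;> simp_all

theorem IsCubic.not_separates (hG : G.IsCubic) (h5 : G.CyclicallyEdgeConnected 5)
    (hcut : (G.cutEdges U).ncard = 5) {P S : Set G.V} (hP : P ⊆ Uᶜ) (hS : S ⊆ Uᶜ)
    (hne : P.Nonempty) (hPS : Disjoint P S) (hcard : S.ncard ≤ 2)
    (hsep : ∀ a ∈ P, ∀ b ∉ P ∪ S, ¬ G.Adj a b) : False := by
  have h1 := hG.ncard_cutEdges_add_le hPS hsep
  have h2 := hG.min_le_ncard_cutEdges h5 hcut hP hne
  have h3 := hG.min_le_ncard_cutEdges h5 hcut (Set.union_subset hP hS) (hne.mono (by simp))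
  rw [Set.ncard_union_eq hPS] at h3
  have hpos : 0 < P.ncard := (Set.ncard_pos).2 hne
  omega

theorem IsCubic.exists_of_separates (hG : G.IsCubic) (h5 : G.CyclicallyEdgeConnected 5)
    (hcut : (G.cutEdges U).ncard = 5) {P Q S : Set G.V} (hU : ∀ x, x ∉ U ↔ x ∈ P ∨ x ∈ Q ∨ x ∈ S)
    (hPne : P.Nonempty) (hQne : Q.Nonempty) (hPQ : Disjoint P Q) (hPS : Disjoint P S)
    (hQS : Disjoint Q S) (hcard : S.ncard ≤ 1)
    (hsep : ∀ a ∈ P, ∀ b ∈ Q, ¬ G.Adj a b) :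
    ∃ p x, P = {p} ∧ S = {x} ∧ ∃ w ∈ U, G.Adj x w := by
  have hP : P ⊆ Uᶜ := fun x hx => (hU x).2 (Or.inl hx)
  have hQ : Q ⊆ Uᶜ := fun x hx => (hU x).2 (Or.inr (Or.inl hx))
  have hS : S ⊆ Uᶜ := fun x hx => (hU x).2 (Or.inr (Or.inr hx))
  have hPpos : 0 < P.ncard := (Set.ncard_pos).2 hPne
  have hQpos : 0 < Q.ncard := (Set.ncard_pos).2 hQne
  have dP := hG.min_le_ncard_cutEdges h5 hcut hP hPne
  have dQ := hG.min_le_ncard_cutEdges h5 hcut hQ hQne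
  have dPS := hG.min_le_ncard_cutEdges h5 hcut (Set.union_subset hP hS) (hPne.mono (by simp))
  have dQS := hG.min_le_ncard_cutEdges h5 hcut (Set.union_subset hQ hS) (hQne.mono (by simp))
  rw [Set.ncard_union_eq hPS] at dPS
  rw [Set.ncard_union_eq hQS] at dQS
  have hS3 := hG.three_mul_ncard S
  have key : ∀ e : G.E, ∃ a b, G.ends e = s(a, b) ∧ (a ∈ P → b ∉ Q) ∧ (b ∈ P → a ∉ Q) := by
    intro e
    obtain ⟨a, b, h⟩ := exists_ends e
    exact ⟨a, b, h, fun ha hb => hsep a ha b hb ⟨e, h⟩,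
      fun hb ha => hsep b hb a ha ⟨e, h.trans Sym2.eq_swap⟩⟩
  have loc : ∀ a, (a ∈ U ∧ a ∉ P ∧ a ∉ Q ∧ a ∉ S) ∨ (a ∉ U ∧ a ∈ P ∧ a ∉ Q ∧ a ∉ S) ∨
      (a ∉ U ∧ a ∉ P ∧ a ∈ Q ∧ a ∉ S) ∨ (a ∉ U ∧ a ∉ P ∧ a ∉ Q ∧ a ∈ S) := by
    intro a
    have h0 := hU a
    have h1 : a ∈ P → a ∉ Q := fun h => Set.disjoint_left.1 hPQ h
    have h2 : a ∈ P → a ∉ S := fun h => Set.disjoint_left.1 hPS h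
    have h3 : a ∈ Q → a ∉ S := fun h => Set.disjoint_left.1 hQS h
    clear * - h0 h1 h2 h3
    by_cases a ∈ P <;> by_cases a ∈ Q <;> by_cases a ∈ S <;> simp_all
  have hsum : (G.cutEdges (P ∪ S)).ncard + (G.cutEdges (Q ∪ S)).ncard ≤
      (G.cutEdges U).ncard + (G.cutEdges S).ncard := by
    simp only [ncard_cutEdges_eq_sum, ← Finset.sum_add_distrib]
    refine Finset.sum_le_sum fun e _ => ?_
    obtain ⟨a, b, h, h1, h2⟩ := key e
    simp only [mem_cutEdges_of_ends h, Set.mem_union]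
    rcases loc a with ha | ha | ha | ha <;> rcases loc b with hb | hb | hb | hb <;>
      simp [ha, hb] at h1 h2 ⊢
  have hS1 : S.ncard = 1 := by omega
  have hP1 : P.ncard = 1 := by omega
  have hQ1 : Q.ncard = 1 := by omega
  have hadj : ∃ x ∈ S, ∃ w ∈ U, G.Adj x w := by
    by_contra hno
    push Not at hno
    have hsum' : (G.cutEdges U).ncard + (G.cutEdges S).ncard ≤
        (G.cutEdges P).ncard + (G.cutEdges Q).ncard := by
      simp only [ncard_cutEdges_eq_sum, ← Finset.sum_add_distrib]
      refine Finset.sum_le_sum fun e _ => ?_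
      obtain ⟨a, b, h, h1, h2⟩ := key e
      have h3 : a ∈ S → b ∉ U := fun ha hb => hno a ha b hb ⟨e, h⟩
      have h4 : b ∈ S → a ∉ U := fun hb ha => hno b hb a ha ⟨e, h.trans Sym2.eq_swap⟩
      simp only [mem_cutEdges_of_ends h]
      rcases loc a with ha | ha | ha | ha <;> rcases loc b with hb | hb | hb | hb <;>
        simp [ha, hb] at h1 h2 h3 h4 ⊢
    have dS := hG.min_le_ncard_cutEdges h5 hcut hS ((Set.ncard_pos).1 (by omega))
    have hP3 := hG.three_mul_ncard P
    have hQ3 := hG.three_mul_ncard Q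
    omega
  obtain ⟨p, rfl⟩ := Set.ncard_eq_one.1 hP1
  obtain ⟨x, rfl⟩ := Set.ncard_eq_one.1 hS1
  obtain ⟨_, rfl, hw⟩ := hadj
  exact ⟨p, _, rfl, rfl, hw⟩

end FiveCut

section Contract

variable (U : Set G.V)

/-- The vertex of `G.contract U` replacing `U`. -/
def contractPoint : (G.contract U).V := (none : Option {x : G.V // x ∉ U})

/-- The vertex of `G.contract U` onto which a vertex of `G` is mapped. -/
def contractMap (x : G.V) : (G.contract U).V :=
  (if h : x ∈ U then none else some ⟨x, h⟩ : Option {x : G.V // x ∉ U})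

/-- The edge of `G` giving rise to an edge of `G.contract U`. -/
def contractEdge : (G.contract U).E ↪ G.E := ⟨Subtype.val, Subtype.val_injective⟩

theorem contractMap_of_mem {x : G.V} (h : x ∈ U) : contractMap U x = contractPoint U :=
  dif_pos h

theorem contractMap_of_notMem {x : G.V} (h : x ∉ U) :
    contractMap U x = (some ⟨x, h⟩ : Option {x : G.V // x ∉ U}) := dif_neg h

theorem contractMap_eq_contractPoint {x : G.V} : contractMap U x = contractPoint U ↔ x ∈ U := by
  refine ⟨fun h => ?_, contractMap_of_mem U⟩
  by_contra hx
  rw [contractMap_of_notMem U hx] at h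
  exact Option.some_ne_none _ h

theorem contractMap_injOn : Set.InjOn (contractMap U) Uᶜ := by
  intro x hx y hy h
  rw [contractMap_of_notMem U hx, contractMap_of_notMem U hy] at h
  exact congrArg Subtype.val (Option.some.inj h)

theorem contractMap_surjective (hU : U.Nonempty) : Function.Surjective (contractMap U) := by
  rintro (_ | ⟨x, hx⟩)
  · exact ⟨hU.some, contractMap_of_mem U hU.some_mem⟩
  · exact ⟨x, contractMap_of_notMem U hx⟩

theorem contract_ends (e : (G.contract U).E) :
    (G.contract U).ends e = (G.ends (contractEdge U e)).map (contractMap U) := rfl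

theorem contract_ends_of_ends {f : (G.contract U).E} {a b : G.V}
    (h : G.ends (contractEdge U f) = s(a, b)) :
    (G.contract U).ends f = s(contractMap U a, contractMap U b) := by
  rw [contract_ends, h, Sym2.map_mk]

theorem mem_cutEdges_contract (A : Set (G.contract U).V) (e : (G.contract U).E) :
    e ∈ (G.contract U).cutEdges A ↔ contractEdge U e ∈ G.cutEdges (contractMap U ⁻¹' A) := by
  obtain ⟨a, b, h⟩ := exists_ends (contractEdge U e)
  rw [mem_cutEdges_of_ends h, mem_cutEdges_of_ends (contract_ends_of_ends U h)]
  rfl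

theorem exists_contractEdge_eq {e : G.E} {a b : G.V} (h : G.ends e = s(a, b))
    (hab : a ∉ U ∨ b ∉ U) : ∃ f : (G.contract U).E, contractEdge U f = e := by
  refine ⟨⟨e, fun hall => ?_⟩, rfl⟩
  rw [h] at hall
  rcases hab with h1 | h1
  · exact h1 (hall a (by simp))
  · exact h1 (hall b (by simp))

theorem ncard_cutEdges_contract (A : Set (G.contract U).V) :
    ((G.contract U).cutEdges A).ncard = (G.cutEdges (contractMap U ⁻¹' A)).ncard := by
  refine Set.ncard_congr (fun e _ => contractEdge U e)
    (fun e he => (mem_cutEdges_contract U A e).1 he)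
    (fun e f _ _ h => (contractEdge U).injective h) fun e he => ?_
  obtain ⟨a, b, h⟩ := exists_ends e
  have hab : a ∉ U ∨ b ∉ U := by
    by_contra hcon
    push Not at hcon
    rw [mem_cutEdges_of_ends h, Set.mem_preimage, Set.mem_preimage,
      contractMap_of_mem U hcon.1, contractMap_of_mem U hcon.2] at he
    tauto
  obtain ⟨f, rfl⟩ := exists_contractEdge_eq U h hab
  exact ⟨f, (mem_cutEdges_contract U A f).2 he, rfl⟩

theorem HasCycleWithin.of_contract {A : Set (G.contract U).V}
    (hA : contractPoint U ∉ A) (h : (G.contract U).HasCycleWithin A) :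
    G.HasCycleWithin (contractMap U ⁻¹' A) := by
  obtain ⟨F, hF, hFA, hd⟩ := h
  have hmem : ∀ e ∈ F, ∀ v ∈ G.ends (contractEdge U e), contractMap U v ∈ A := fun e he v hv =>
    hFA e he _ (by rw [contract_ends]; exact Sym2.mem_map.2 ⟨v, hv, rfl⟩)
  have hnotU : ∀ e ∈ F, ∀ v ∈ G.ends (contractEdge U e), v ∉ U := fun e he v hv hvU =>
    hA (contractMap_of_mem U hvU ▸ hmem e he v hv)
  refine ⟨F.map (contractEdge U), hF.map, ?_, fun v => ?_⟩
  · intro e he v hv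
    obtain ⟨f, hf, rfl⟩ := Finset.mem_map.1 he
    exact hmem f hf v hv
  · rw [Finset.sum_map]
    have := hd (contractMap U v)
    by_cases hvU : v ∈ U
    · rw [Finset.sum_eq_zero]
      · simp
      intro e he
      obtain ⟨a, b, hab⟩ := exists_ends (contractEdge U e)
      have ha := hnotU e he a (by simp [hab])
      have hb := hnotU e he b (by simp [hab])
      have hva : v ≠ a := fun h => ha (h ▸ hvU)
      have hvb : v ≠ b := fun h => hb (h ▸ hvU)
      exact (inc_of_ends hab v).trans (by simp [hva, hvb])
    · convert this using 1
      refine Finset.sum_congr rfl fun e he => ?_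
      obtain ⟨a, b, hab⟩ := exists_ends (contractEdge U e)
      have ha := hnotU e he a (by simp [hab])
      have hb := hnotU e he b (by simp [hab])
      refine (inc_of_ends hab v).trans ?_
      rw [inc_of_ends (contract_ends_of_ends U hab), (contractMap_injOn U).eq_iff hvU ha,
        (contractMap_injOn U).eq_iff hvU hb]

variable {U}

theorem IsCubic.cyclicallyEdgeConnected_contract (hG : G.IsCubic)
    (h5 : G.CyclicallyEdgeConnected 5) (hcut : (G.cutEdges U).ncard = 5) :
    (G.contract U).CyclicallyEdgeConnected 5 := by
  have key : ∀ A : Set (G.contract U).V, contractPoint U ∉ A →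
      (G.contract U).HasCycleWithin A → 5 ≤ ((G.contract U).cutEdges A).ncard := by
    intro A hA hc
    rw [ncard_cutEdges_contract]
    exact hG.five_le_ncard_cutEdges h5 hcut
      (fun x hx hxU => hA (contractMap_of_mem U hxU ▸ hx)) (hc.of_contract U hA)
  rintro A ⟨h1, h2⟩
  by_cases hA : contractPoint U ∈ A
  · rw [← cutEdges_compl]
    exact key Aᶜ (fun h => h hA) h2
  · exact key A hA h1

theorem ncard_preimage_contractMap_le {T : Set (G.contract U).V}
    (hT : contractPoint U ∉ T) :
    (contractMap U ⁻¹' T).ncard ≤ T.ncard := by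
  refine Set.ncard_le_ncard_of_injOn (contractMap U) (fun x hx => hx) ?_
  exact (contractMap_injOn U).mono fun x hx hxU => hT (contractMap_of_mem U hxU ▸ hx)

theorem IsCubic.four_le_card_contract (hG : G.IsCubic) (hcut : (G.cutEdges U).ncard = 5) :
    4 ≤ Fintype.card (G.contract U).V := by
  have h := hG.three_mul_ncard Uᶜ
  rw [cutEdges_compl, hcut] at h
  have h2 : Nat.card (G.contract U).V = Uᶜ.ncard + 1 := by
    change Nat.card (Option {x : G.V // x ∉ U}) = _
    rw [Finite.card_option]
    rfl
  rw [Nat.card_eq_fintype_card] at h2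
  omega

/-- In a matching covered graph, deleting the two ends of an edge leaves no isolated vertex. -/
theorem MatchingCovered.exists_adj {H : Multigraph} (hH : H.MatchingCovered) {x y p : H.V}
    (hxy : H.Adj x y) (hpx : p ≠ x) (hpy : p ≠ y) :
    ∃ q, q ≠ p ∧ q ≠ x ∧ q ≠ y ∧ H.Adj p q := by
  obtain ⟨e, he⟩ := hxy
  obtain ⟨M, ⟨hloop, hM⟩, heM⟩ := hH e
  obtain ⟨f, ⟨hfM, hpf⟩, -⟩ := hM p
  obtain ⟨q, hq⟩ := hpf
  have hfe : ∀ v, v ∈ H.ends e → v ∈ H.ends f → False := by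
    intro v hve hvf
    have h : f = e := (hM v).unique ⟨hfM, hvf⟩ ⟨heM, hve⟩
    have hp : p ∈ H.ends f := by simp [hq]
    rw [h, he, Sym2.mem_iff] at hp
    exact hp.elim hpx hpy
  refine ⟨q, ?_, ?_, ?_, f, hq⟩
  · rintro rfl
    exact hloop f hfM (by simp [hq])
  · rintro rfl
    exact hfe q (by simp [he]) (by simp [hq])
  · rintro rfl
    exact hfe q (by simp [he]) (by simp [hq])

theorem IsCubic.vertexConnected_contract (hG : G.IsCubic) (h5 : G.CyclicallyEdgeConnected 5)
    (hU : U.Nonempty) (hcut : (G.cutEdges U).ncard = 5) (hmc : (G.contract U).MatchingCovered) :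
    (G.contract U).VertexConnected 3 := by
  refine ⟨hG.four_le_card_contract hcut, fun T hT u hu v hv => ?_⟩
  by_contra hcon
  set P : Set (G.contract U).V :=
    {w | Relation.ReflTransGen ((G.contract U).AdjOn Tᶜ) u w} with hPdef
  have hPT : ∀ w ∈ P, w ∉ T := by
    intro w hw
    rcases Relation.ReflTransGen.cases_tail hw with h | ⟨_, _, h⟩
    · exact h ▸ hu
    · exact h.2.1
  have hclosed : ∀ a ∈ P, ∀ b, b ∉ P → b ∉ T → ¬ (G.contract U).Adj a b :=
    fun a ha b hb hbT hab => hb (Relation.ReflTransGen.tail ha ⟨hPT a ha, hbT, hab⟩)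
  have hsep : ∀ a, contractMap U a ∈ P → ∀ b, contractMap U b ∉ P → contractMap U b ∉ T →
      ¬ G.Adj a b := by
    rintro a ha b hb hbT ⟨e, he⟩
    have hab : a ∉ U ∨ b ∉ U := by
      by_contra hcon
      push Not at hcon
      exact hb ((contractMap_of_mem U hcon.2).trans (contractMap_of_mem U hcon.1).symm ▸ ha)
    obtain ⟨f, rfl⟩ := exists_contractEdge_eq U he hab
    exact hclosed _ ha _ hb hbT ⟨f, contract_ends_of_ends U he⟩
  obtain ⟨u', hu'⟩ := contractMap_surjective U hU u
  obtain ⟨v', hv'⟩ := contractMap_surjective U hU v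
  have huP : contractMap U u' ∈ P := hu' ▸ Relation.ReflTransGen.refl
  have hvP : contractMap U v' ∉ P := hv' ▸ hcon
  have hvT : contractMap U v' ∉ T := hv' ▸ hv
  by_cases hnT : contractPoint U ∈ T
  · have hnP : contractPoint U ∉ P := fun h => hPT _ h hnT
    have hcard : (contractMap U ⁻¹' (T \ {contractPoint U})).ncard ≤ 1 := by
      have h1 := Set.ncard_sdiff_singleton_add_one hnT
      have h2 := ncard_preimage_contractMap_le (U := U)
        (T := T \ {contractPoint U}) (fun h => h.2 rfl)
      exact h2.trans (by omega)
    have hTU : ∀ x ∈ U, contractMap U x ∈ T := fun x hx => contractMap_of_mem U hx ▸ hnT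
    have hPU : ∀ x ∈ U, contractMap U x ∉ P := fun x hx => contractMap_of_mem U hx ▸ hnP
    obtain ⟨p, x, hp, hx, w, hwU, hxw⟩ := hG.exists_of_separates h5 hcut
      (P := contractMap U ⁻¹' P) (Q := contractMap U ⁻¹' (P ∪ T)ᶜ)
      (S := contractMap U ⁻¹' (T \ {contractPoint U}))
      (fun x => by
        refine ⟨fun hx => ?_, ?_⟩
        · by_cases h1 : contractMap U x ∈ P
          · exact Or.inl h1
          by_cases h2 : contractMap U x ∈ T
          · exact Or.inr (Or.inr ⟨h2, fun h => hx ((contractMap_eq_contractPoint U).1 h)⟩)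
          · exact Or.inr (Or.inl fun h => h.elim h1 h2)
        · rintro (h | h | h) hx
          · exact hPU x hx h
          · exact h (Or.inr (hTU x hx))
          · exact h.2 (contractMap_of_mem U hx))
      ⟨u', huP⟩ ⟨v', fun h => h.elim hvP hvT⟩
      (Set.disjoint_left.2 fun a ha hb => hb (Or.inl ha))
      (Set.disjoint_left.2 fun a ha hb => hPT _ ha hb.1)
      (Set.disjoint_left.2 fun a ha hb => ha (Or.inr hb.1))
      hcard
      (fun a ha b hb => hsep a ha b (fun h => hb (Or.inl h)) fun h => hb (Or.inr h))
    have hpP : contractMap U p ∈ P := by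
      have : p ∈ contractMap U ⁻¹' P := hp ▸ rfl
      exact this
    have hxT : contractMap U x ∈ T \ {contractPoint U} := by
      have : x ∈ contractMap U ⁻¹' (T \ {contractPoint U}) := hx ▸ rfl
      exact this
    have hxU : x ∉ U := fun h => hxT.2 (contractMap_of_mem U h)
    obtain ⟨e, he⟩ := hxw
    obtain ⟨f, rfl⟩ := exists_contractEdge_eq U he (Or.inl hxU)
    obtain ⟨q, hqp, hqx, hqw, hpq⟩ := hmc.exists_adj ⟨f, contract_ends_of_ends U he⟩
      (p := contractMap U p) (fun h => hPT _ hpP (h ▸ hxT.1))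
      (fun h => hPT _ hpP (h ▸ hTU w hwU))
    obtain ⟨q', rfl⟩ := contractMap_surjective U hU q
    refine hclosed _ hpP _ (fun h => ?_) (fun h => ?_) hpq
    · have : q' ∈ ({p} : Set G.V) := hp ▸ h
      exact hqp (congrArg _ this)
    · have : q' ∈ ({x} : Set G.V) := by
        rw [← hx]
        refine ⟨h, fun hn => hqw ?_⟩
        rw [contractMap_of_mem U hwU]
        exact hn
      exact hqx (congrArg _ this)
  · have hTU : contractMap U ⁻¹' T ⊆ Uᶜ :=
      fun x hx hxU => hnT (contractMap_of_mem U hxU ▸ hx)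
    have hcard := (ncard_preimage_contractMap_le hnT).trans hT
    by_cases hnP : contractPoint U ∈ P
    · have hPU : ∀ x ∈ U, contractMap U x ∈ P := fun x hx => contractMap_of_mem U hx ▸ hnP
      refine hG.not_separates h5 hcut (P := contractMap U ⁻¹' (P ∪ T)ᶜ)
        (fun x hx hxU => hx (Or.inl (hPU x hxU))) hTU ⟨v', fun h => h.elim hvP hvT⟩
        (Set.disjoint_left.2 fun a ha hb => ha (Or.inr hb)) hcard ?_
      rintro a ha b hb ⟨e, he⟩
      have hbP : contractMap U b ∈ P := by
        simp only [Set.mem_union, Set.mem_preimage, Set.mem_compl_iff] at hb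
        tauto
      exact hsep b hbP a (fun h => ha (Or.inl h)) (fun h => ha (Or.inr h))
        ⟨e, he.trans Sym2.eq_swap⟩
    · exact hG.not_separates h5 hcut (P := contractMap U ⁻¹' P)
        (fun x hx hxU => hnP (contractMap_of_mem U hxU ▸ hx)) hTU ⟨u', huP⟩
        (Set.disjoint_left.2 fun a ha hb => hPT _ ha hb) hcard
        (fun a ha b hb => hsep a ha b (fun h => hb (Or.inl h)) fun h => hb (Or.inr h))

end Contract

end Multigraph

/-- Let `G` be a cyclically 5-edge-connected cubic graph and
let `E(U, U')` be a 5-edge-cut of `G`. If `G/U` is matching covered, then `G/U`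
is cyclically 5-edge-connected and 3-vertex-connected. -/
theorem contract_of_fiveCut_connectivity (G : Multigraph)
    (hcubic : G.IsCubic) (h5 : G.CyclicallyEdgeConnected 5)
    (U : Set G.V) (hU : U.Nonempty) (hU' : U ≠ Set.univ)
    (hcut : (G.cutEdges U).ncard = 5)
    (hmc : (G.contract U).MatchingCovered) :
    (G.contract U).CyclicallyEdgeConnected 5 ∧ (G.contract U).VertexConnected 3 := by
  exact ⟨hcubic.cyclicallyEdgeConnected_contract h5 hcut,
    hcubic.vertexConnected_contract h5 hU hcut hmc⟩
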